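/- There exists a Slovak space which is an indecomposable continuum; that is, there exists a compact connected metric space X which is not the union of two proper subcontinua, having at least three points, together with a minimal homeomorphism T : X → X such that every self-homeomorphism of X equals T^n for some n ∈ ℤ. -/

import Mathlib

open Set Filter Topology

/-- Integer powers (iterates) of a self-homeomorphism: `hzpow T n = Tⁿ` for `n : ℤ`. -/
def hzpow {X : Type*} [TopologicalSpace X] (T : X ≃ₜ X) : ℤ → (X ≃ₜ X)
  | Int.ofNat n => (fun S => S.trans T)^[n] (Homeomorph.refl X)
  | Int.negSucc n => ((fun S => S.trans T)^[n + 1] (Homeomorph.refl X)).symm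

/-- A self-map of a topological space is minimal if every forward orbit is dense. -/
def IsMinimal {X : Type*} [TopologicalSpace X] (T : X → X) : Prop :=
  ∀ x : X, Dense (Set.range fun n : ℕ => T^[n] x)

namespace SlovakInd

/-! ### The one-parameter subgroup of the dyadic solenoid -/

/-- The one-parameter subgroup. -/
noncomputable def phi (t : ℝ) : ℕ → Circle := fun k => Circle.exp (t / 2 ^ k)

lemma phi_add (s t : ℝ) : phi (s + t) = phi s * phi t := by
  funext k
  simp [phi, add_div, Circle.exp_add]

lemma phi_zero : phi 0 = 1 := by
  funext k
  simp [phi]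

lemma phi_neg (t : ℝ) : phi (-t) = (phi t)⁻¹ := by
  rw [eq_inv_iff_mul_eq_one, ← phi_add, neg_add_cancel, phi_zero]

lemma continuous_phi : Continuous phi := by
  refine continuous_pi fun k => ?_
  exact Circle.exp.continuous.comp (continuous_id.div_const _)

lemma phi_sq (t : ℝ) (k : ℕ) : phi t (k + 1) ^ 2 = phi t k := by
  simp only [phi]
  rw [sq, ← Circle.exp_add]
  congr 1
  rw [pow_succ]
  field_simp
  norm_num

lemma eq_zero_of_phi {t : ℝ} (h : phi t = 1) : t = 0 := by
  obtain ⟨k, hk⟩ := pow_unbounded_of_one_lt |t| (by norm_num : (1 : ℝ) < 2)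
  have h1 := congrFun h k
  simp only [phi, Pi.one_apply] at h1
  obtain ⟨n, hn⟩ := Circle.exp_eq_one.1 h1
  have hpos : (0 : ℝ) < 2 ^ k := by positivity
  have h2 : |t / 2 ^ k| < 1 := by
    rw [abs_div, abs_of_pos hpos, div_lt_one hpos]
    exact hk
  have hn0 : n = 0 := by
    by_contra hne
    have h3 : (1 : ℝ) ≤ |(n : ℝ)| := by
      have := Int.one_le_abs hne
      exact_mod_cast this
    rw [hn, abs_mul, abs_of_pos (by positivity : (0 : ℝ) < 2 * Real.pi)] at h2
    nlinarith [Real.pi_gt_three]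
  rw [hn0] at hn
  simp at hn
  exact hn

lemma phi_inj {s t : ℝ} (h : phi s = phi t) : s = t := by
  have : phi (s - t) = 1 := by
    rw [sub_eq_add_neg, phi_add, phi_neg, h, mul_inv_cancel]
  linarith [eq_zero_of_phi this]

/-! ### The weight and the oscillating function -/

/-- A continuous function vanishing only at the identity. -/
noncomputable def w (z : ℕ → Circle) : ℝ := ∑' k, (1 / 2 : ℝ) ^ k * ‖(z k : ℂ) - 1‖

lemma w_bound (z : ℕ → Circle) (k : ℕ) :
    ‖(1 / 2 : ℝ) ^ k * ‖(z k : ℂ) - 1‖‖ ≤ (1 / 2 : ℝ) ^ k * 2 := by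
  rw [norm_mul, norm_norm, Real.norm_of_nonneg (by positivity)]
  gcongr
  calc ‖(z k : ℂ) - 1‖ ≤ ‖(z k : ℂ)‖ + ‖(1 : ℂ)‖ := norm_sub_le _ _
    _ = 2 := by rw [Circle.norm_coe]; norm_num

lemma summable_bound : Summable fun k : ℕ => (1 / 2 : ℝ) ^ k * 2 :=
  summable_geometric_two.mul_right 2

lemma w_summable (z : ℕ → Circle) : Summable fun k : ℕ => (1 / 2 : ℝ) ^ k * ‖(z k : ℂ) - 1‖ :=
  Summable.of_norm_bounded summable_bound (w_bound z)

lemma continuous_w : Continuous w := by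
  refine continuous_tsum (fun k => ?_) summable_bound (fun k z => w_bound z k)
  fun_prop

lemma w_nonneg (z : ℕ → Circle) : 0 ≤ w z := tsum_nonneg fun k => by positivity

lemma eq_one_of_w {z : ℕ → Circle} (h : w z = 0) : z = 1 := by
  have h1 := (hasSum_zero_iff_of_nonneg (fun k => by positivity)).1
    (h ▸ (w_summable z).hasSum : HasSum (fun k : ℕ => (1 / 2 : ℝ) ^ k * ‖(z k : ℂ) - 1‖) 0)
  funext k
  have h2 := congrFun h1 k
  simp only [Pi.zero_apply, mul_eq_zero] at h2
  rcases h2 with h2 | h2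
  · exact absurd h2 (by positivity)
  · rw [norm_eq_zero, sub_eq_zero] at h2
    exact Circle.coe_eq_one.1 h2

lemma w_one : w 1 = 0 := by simp [w]

lemma w_phi_le (t : ℝ) : w (phi t) ≤ 2 * |t| := by
  have h1 : ∀ k : ℕ, (1 / 2 : ℝ) ^ k * ‖((phi t k : Circle) : ℂ) - 1‖ ≤ (1 / 2 : ℝ) ^ k * |t| := by
    intro k
    gcongr
    have := Real.norm_exp_I_mul_ofReal_sub_one_le (x := t / 2 ^ k)
    rw [mul_comm] at this
    simp only [phi, Circle.coe_exp]
    refine this.trans ?_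
    rw [Real.norm_eq_abs, abs_div, abs_of_pos (by positivity : (0 : ℝ) < 2 ^ k)]
    exact div_le_self (abs_nonneg _) (one_le_pow₀ (by norm_num))
  calc w (phi t) ≤ ∑' k : ℕ, (1 / 2 : ℝ) ^ k * |t| :=
        (w_summable _).tsum_le_tsum h1 (summable_geometric_two.mul_right _)
    _ = 2 * |t| := by rw [tsum_mul_right, tsum_geometric_two]

/-- The function with a single, one-sided oscillating discontinuity at the identity. -/
noncomputable def f (z : ℕ → Circle) : ℝ :=
  max (-1) (min 1 (4 * max 0 (z 0 : ℂ).im / w z * Real.sin (1 / w z)))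

lemma f_mem (z : ℕ → Circle) : f z ∈ Icc (-1 : ℝ) 1 :=
  ⟨le_max_left _ _, max_le (by norm_num) (min_le_left _ _)⟩

lemma f_one : f 1 = 0 := by simp [f]

lemma continuousAt_f {z : ℕ → Circle} (hz : z ≠ 1) : ContinuousAt f z := by
  have hw : w z ≠ 0 := fun h => hz (eq_one_of_w h)
  have h1 : ContinuousAt w z := continuous_w.continuousAt
  have h2 : ContinuousAt (fun z : ℕ → Circle => ((z 0 : Circle) : ℂ).im) z := by
    have : Continuous (fun z : ℕ → Circle => ((z 0 : Circle) : ℂ)) := by fun_prop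
    exact (Complex.continuous_im.comp this).continuousAt
  unfold f
  refine ContinuousAt.sup continuousAt_const (ContinuousAt.inf continuousAt_const ?_)
  refine ContinuousAt.mul ?_ ?_
  · exact (continuousAt_const.mul (ContinuousAt.sup continuousAt_const h2)).div h1 hw
  · exact Real.continuous_sin.continuousAt.comp (continuousAt_const.div h1 hw)

lemma phi_im (t : ℝ) : ((phi t 0 : Circle) : ℂ).im = Real.sin t := by
  simp [phi, Circle.coe_exp, Complex.exp_ofReal_mul_I_im]

lemma f_phi_neg {t : ℝ} (h1 : -1 < t) (h2 : t ≤ 0) : f (phi t) = 0 := by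
  have h3 : Real.sin t ≤ 0 :=
    Real.sin_nonpos_of_nonpos_of_neg_pi_le h2 (by linarith [Real.pi_gt_three])
  simp [f, phi_im, max_eq_left h3]

lemma w_phi_pos {t : ℝ} (h : t ≠ 0) : 0 < w (phi t) :=
  lt_of_le_of_ne (w_nonneg _) fun hw => h (eq_zero_of_phi (eq_one_of_w hw.symm))

/-- Oscillation on the right. -/
lemma f_osc {y : ℝ} (hy : y ∈ Icc (-1 : ℝ) 1) {e : ℝ} (he : 0 < e) :
    ∃ t, 0 < t ∧ t < e ∧ f (phi t) = y := by
  set e' := min (e / 2) 1 with he'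
  have he0 : 0 < e' := by positivity
  have hcw : Continuous fun t => w (phi t) := continuous_w.comp continuous_phi
  have key : ∀ v, 0 < v → v ≤ w (phi e') → ∃ t, 0 < t ∧ t ≤ e' ∧ w (phi t) = v := by
    intro v hv hv'
    have := intermediate_value_Icc he0.le hcw.continuousOn
    have h0 : w (phi 0) = 0 := by rw [phi_zero, w_one]
    obtain ⟨t, ht, htv⟩ := this (⟨by rw [h0]; exact hv.le, hv'⟩ : v ∈ Icc (w (phi 0)) (w (phi e')))
    refine ⟨t, lt_of_le_of_ne ht.1 ?_, ht.2, htv⟩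
    rintro rfl
    simp only [h0] at htv
    exact hv.ne htv
  have hwpos : 0 < w (phi e') := w_phi_pos he0.ne'
  obtain ⟨N, hN⟩ := exists_nat_gt (1 / w (phi e'))
  have hpi := Real.pi_gt_three
  have hgain : ∀ t, 0 < t → t ≤ e' → 1 ≤ 4 * max 0 (Real.sin t) / w (phi t) := by
    intro t ht ht'
    have ht1 : t ≤ 1 := ht'.trans (min_le_right _ _)
    have hs : t / 2 ≤ Real.sin t := by
      have := Real.mul_le_sin ht.le (by linarith : t ≤ Real.pi / 2)
      have h4 : (1 : ℝ) / 2 ≤ 2 / Real.pi := by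
        rw [div_le_div_iff₀ (by norm_num) Real.pi_pos]
        linarith [Real.pi_le_four]
      nlinarith
    rw [le_div_iff₀ (w_phi_pos ht.ne'), one_mul]
    have := w_phi_le t
    rw [abs_of_pos ht] at this
    have := le_max_right 0 (Real.sin t)
    linarith
  have hex : ∀ c : ℝ, 0 ≤ c → ∃ t, 0 < t ∧ t ≤ e' ∧ 1 / w (phi t) = c + (N + 1 : ℕ) * (2 * Real.pi) := by
    intro c hc
    have hbig : (N : ℝ) < c + (N + 1 : ℕ) * (2 * Real.pi) := by
      push_cast
      nlinarith [Nat.cast_nonneg (α := ℝ) N]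
    have hpos : 0 < c + (N + 1 : ℕ) * (2 * Real.pi) := lt_of_le_of_lt (Nat.cast_nonneg _) hbig
    obtain ⟨t, h1, h2, h3⟩ := key (1 / (c + (N + 1 : ℕ) * (2 * Real.pi))) (by positivity) (by
      rw [div_le_iff₀ hpos, mul_comm, ← div_le_iff₀ hwpos]
      exact (hN.trans hbig).le)
    refine ⟨t, h1, h2, ?_⟩
    rw [h3, one_div_one_div]
  obtain ⟨a, ha0, hae, ha⟩ := hex (Real.pi / 2) (by positivity)
  obtain ⟨b, hb0, hbe, hb⟩ := hex (3 * Real.pi / 2) (by positivity)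
  have fa : f (phi a) = 1 := by
    have hs : Real.sin (1 / w (phi a)) = 1 := by
      rw [ha, Real.sin_add_nat_mul_two_pi, Real.sin_pi_div_two]
    rw [f, phi_im, hs, mul_one, min_eq_left (hgain a ha0 hae)]
    norm_num
  have fb : f (phi b) = -1 := by
    have hs : Real.sin (1 / w (phi b)) = -1 := by
      rw [hb, Real.sin_add_nat_mul_two_pi,
        show 3 * Real.pi / 2 = Real.pi / 2 + Real.pi by ring, Real.sin_add_pi,
        Real.sin_pi_div_two]
    have := hgain b hb0 hbe
    rw [f, phi_im, hs]
    apply max_eq_left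
    exact (min_le_right _ _).trans (by linarith)
  have hcont : ContinuousOn (fun t => f (phi t)) (Ioc 0 e') := by
    intro t ht
    refine ContinuousAt.continuousWithinAt ?_
    exact (continuousAt_f fun h => ht.1.ne' (eq_zero_of_phi h)).comp continuous_phi.continuousAt
  have hpre := isPreconnected_Ioc.intermediate_value (⟨hb0, hbe⟩ : b ∈ Ioc 0 e')
    (⟨ha0, hae⟩ : a ∈ Ioc 0 e') hcont
  simp only [fa, fb] at hpre
  obtain ⟨t, ht, hty⟩ := hpre hy
  exact ⟨t, ht.1, lt_of_le_of_lt (ht.2.trans (min_le_left _ _)) (by linarith), hty⟩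

/-! ### The space -/

/-- Membership in the dyadic solenoid. -/
def Sol (x : ℕ → Circle) : Prop := ∀ k, x (k + 1) ^ 2 = x k

lemma sol_phi (t : ℝ) : Sol (phi t) := phi_sq t

lemma Sol.mul {x y : ℕ → Circle} (hx : Sol x) (hy : Sol y) : Sol (x * y) := fun k => by
  simp [mul_pow, hx k, hy k]

/-- The underlying set of the Slovak space. -/
def Xset : Set ((ℕ → Circle) × (ℤ → ℝ)) :=
  {p | Sol p.1 ∧ ∀ n : ℤ, p.2 n ∈ Icc (-1 : ℝ) 1 ∧ (p.1 = phi n ∨ p.2 n = f (phi (-n) * p.1))}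

lemma isClosed_Xset : IsClosed Xset := by
  have h1 : IsClosed {p : (ℕ → Circle) × (ℤ → ℝ) | Sol p.1} := by
    simp only [Sol, ofPred_forall]
    exact isClosed_iInter fun k => isClosed_eq (by fun_prop) (by fun_prop)
  have h2 : ∀ n : ℤ, IsClosed {p : (ℕ → Circle) × (ℤ → ℝ) | p.2 n ∈ Icc (-1 : ℝ) 1} := fun n =>
    isClosed_Icc.preimage (by fun_prop)
  have h3 : ∀ n : ℤ, IsClosed {p : (ℕ → Circle) × (ℤ → ℝ) |
      p.1 = phi n ∨ p.2 n = f (phi (-n) * p.1)} := by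
    intro n
    rw [← isOpen_compl_iff, isOpen_iff_mem_nhds]
    rintro p hp
    simp only [mem_compl_iff, mem_ofPred_eq, not_or] at hp
    have hne : phi (-n) * p.1 ≠ 1 := by
      intro h
      apply hp.1
      rw [phi_neg, inv_mul_eq_one] at h
      exact h.symm
    have hc : ContinuousAt (fun p : (ℕ → Circle) × (ℤ → ℝ) => p.2 n - f (phi (-n) * p.1)) p := by
      refine ContinuousAt.sub (by fun_prop) ?_
      exact (ContinuousAt.comp (f := fun p : (ℕ → Circle) × (ℤ → ℝ) => phi (-n) * p.1)
        (continuousAt_f hne) (by fun_prop))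
    have e1 := hc.eventually_ne (sub_ne_zero.2 hp.2)
    have e2 : ∀ᶠ q : (ℕ → Circle) × (ℤ → ℝ) in 𝓝 p, q.1 ≠ phi n :=
      continuousAt_fst.eventually_ne hp.1
    filter_upwards [e1, e2] with q hq1 hq2
    simp only [mem_compl_iff, mem_ofPred_eq, not_or]
    exact ⟨hq2, sub_ne_zero.1 hq1⟩
  have : Xset = {p | Sol p.1} ∩ ⋂ n : ℤ, ({p | p.2 n ∈ Icc (-1 : ℝ) 1} ∩
      {p | p.1 = phi n ∨ p.2 n = f (phi (-n) * p.1)}) := by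
    ext p
    simp [Xset]
  rw [this]
  exact h1.inter (isClosed_iInter fun n => (h2 n).inter (h3 n))

lemma isCompact_Xset : IsCompact Xset := by
  have hK : IsCompact ((univ : Set (ℕ → Circle)) ×ˢ (Set.pi univ fun _ : ℤ => Icc (-1 : ℝ) 1)) :=
    isCompact_univ.prod (isCompact_univ_pi fun _ => isCompact_Icc)
  refine hK.of_isClosed_subset isClosed_Xset ?_
  rintro p hp
  exact ⟨mem_univ _, fun n _ => (hp.2 n).1⟩

/-- The Slovak space. -/
abbrev X : Type := Xset

instance : CompactSpace X := isCompact_iff_compactSpace.1 isCompact_Xset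

/-- The projection to the solenoid. -/
def pr (p : X) : ℕ → Circle := p.1.1

/-- The fibre coordinates. -/
def co (p : X) : ℤ → ℝ := p.1.2

lemma continuous_pr : Continuous pr := continuous_fst.comp continuous_subtype_val

lemma continuous_co (n : ℤ) : Continuous fun p : X => co p n :=
  (continuous_apply n).comp (continuous_snd.comp continuous_subtype_val)

lemma sol_pr (p : X) : Sol (pr p) := p.2.1

lemma co_mem (p : X) (n : ℤ) : co p n ∈ Icc (-1 : ℝ) 1 := (p.2.2 n).1

lemma co_eq (p : X) {n : ℤ} (h : pr p ≠ phi n) : co p n = f (phi (-n) * pr p) :=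
  (p.2.2 n).2.resolve_left h

lemma X_ext {p q : X} (h1 : pr p = pr q) (h2 : ∀ n, co p n = co q n) : p = q :=
  Subtype.ext (Prod.ext h1 (funext h2))

lemma X_uniq {p q : X} (h1 : pr p = pr q) (h2 : ∀ n : ℤ, pr p ≠ phi n) : p = q := by
  refine X_ext h1 fun n => ?_
  rw [co_eq p (h2 n), co_eq q (h1 ▸ h2 n), h1]

/-- The canonical lift of a point of the solenoid. -/
noncomputable def lift (x : ℕ → Circle) (hx : Sol x) : X :=
  ⟨(x, fun n => f (phi (-n) * x)), hx, fun _ => ⟨f_mem _, Or.inr rfl⟩⟩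

/-- The canonical lift of the flow line through `x`. -/
noncomputable def lam (x : ℕ → Circle) (hx : Sol x) (t : ℝ) : X :=
  lift (phi t * x) ((sol_phi t).mul hx)

lemma pr_lam (x : ℕ → Circle) (hx : Sol x) (t : ℝ) : pr (lam x hx t) = phi t * x := rfl

lemma co_lam (x : ℕ → Circle) (hx : Sol x) (t : ℝ) (n : ℤ) :
    co (lam x hx t) n = f (phi (t - n) * x) := by
  change f (phi (-n) * (phi t * x)) = _
  rw [← mul_assoc, ← phi_add]
  congr 3
  ring

lemma sol_one : Sol 1 := fun k => by simp

/-- The canonical lift of the flow line through the identity. -/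
noncomputable def lam1 (t : ℝ) : X := lam 1 sol_one t

lemma pr_lam1 (t : ℝ) : pr (lam1 t) = phi t := by simp [lam1, pr_lam]

lemma co_lam1 (t : ℝ) (n : ℤ) : co (lam1 t) n = f (phi (t - n)) := by simp [lam1, co_lam]

lemma tendsto_X {ι : Type*} {l : Filter ι} {u : ι → X} {p : X}
    (h1 : Tendsto (fun i => pr (u i)) l (𝓝 (pr p)))
    (h2 : ∀ n, Tendsto (fun i => co (u i) n) l (𝓝 (co p n))) : Tendsto u l (𝓝 p) := by
  rw [tendsto_subtype_rng]
  exact h1.prodMk_nhds (tendsto_pi_nhds.2 h2)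

lemma tendsto_f_phi {t : ℝ} (h : t ≠ 0) : ContinuousAt (fun t => f (phi t)) t :=
  (continuousAt_f fun h' => h (eq_zero_of_phi h')).comp continuous_phi.continuousAt

/-- The arcs are limits of the oscillating part on the right. -/
lemma fibre_mem_closure {p : X} {n : ℤ} (hp : pr p = phi n) :
    p ∈ closure (lam1 '' Ioo (n : ℝ) (n + 1)) := by
  have hex : ∀ j : ℕ, ∃ t, 0 < t ∧ t < 1 / ((j : ℝ) + 1) ∧ f (phi t) = co p n := fun j =>
    f_osc (co_mem p n) (by positivity)
  choose t ht0 ht1 htf using hex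
  have htl : Tendsto t atTop (𝓝 0) := squeeze_zero (fun j => (ht0 j).le) (fun j => (ht1 j).le)
    tendsto_one_div_add_atTop_nhds_zero_nat
  have hnt : Tendsto (fun j => (n : ℝ) + t j) atTop (𝓝 n) := by
    simpa using htl.const_add (n : ℝ)
  refine mem_closure_of_tendsto (f := fun j => lam1 (n + t j)) (b := atTop) (tendsto_X ?_ ?_) ?_
  · simp only [pr_lam1, hp]
    exact (continuous_phi.tendsto _).comp hnt
  · intro m
    simp only [co_lam1]
    by_cases hm : m = n
    · subst hm
      simp [htf]
    · have hne : (n : ℝ) - m ≠ 0 := by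
        rw [sub_ne_zero]
        exact_mod_cast Ne.symm hm
      have hpm : pr p ≠ phi m := by
        rw [hp]
        intro h
        exact hne (sub_eq_zero.2 (phi_inj h))
      rw [co_eq p hpm, hp, ← phi_add, show -(m : ℝ) + n = n - m by ring]
      exact Tendsto.comp (g := fun t => f (phi t)) (tendsto_f_phi hne) (hnt.sub_const (m : ℝ))
  · refine Eventually.of_forall fun j => ⟨_, ⟨?_, ?_⟩, rfl⟩
    · linarith [ht0 j]
    · have : 1 / ((j : ℝ) + 1) ≤ 1 := by
        rw [div_le_one (by positivity)]
        linarith [Nat.cast_nonneg (α := ℝ) j]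
      linarith [ht1 j]

/-- The points with trivial fibre. -/
def Reg : Set X := {p | ∀ n : ℤ, pr p ≠ phi n}

lemma dense_Reg : Dense Reg := by
  intro p
  by_cases h : p ∈ Reg
  · exact subset_closure h
  · simp only [Reg, mem_ofPred_eq, not_forall, not_not] at h
    obtain ⟨n, hn⟩ := h
    refine closure_mono ?_ (fibre_mem_closure hn)
    rintro _ ⟨t, ht, rfl⟩ m hm
    rw [pr_lam1] at hm
    have := phi_inj hm
    rw [this] at ht
    obtain ⟨h1, h2⟩ := ht
    have h1' : n < m := by exact_mod_cast h1
    have h2' : m < n + 1 := by exact_mod_cast h2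
    omega

lemma sol_eq_of_le {x y : ℕ → Circle} (hx : Sol x) (hy : Sol y) {j k : ℕ} (hjk : j ≤ k)
    (h : x k = y k) : x j = y j := by
  induction k, hjk using Nat.le_induction with
  | base => exact h
  | succ k _ ih => exact ih (by rw [← hx k, ← hy k, h])

/-- Irreducibility of the projection. -/
lemma eq_univ_of_proj {C : Set X} (hC : IsClosed C)
    (h : ∀ (k : ℕ) (c : Circle), ∃ p ∈ C, pr p k = c) : C = univ := by
  have hsub : Reg ⊆ C := by
    intro q hq
    have hne : (⋂ k : ℕ, {p : X | p ∈ C ∧ pr p k = pr q k}).Nonempty := by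
      refine IsCompact.nonempty_iInter_of_sequence_nonempty_isCompact_isClosed _ ?_ ?_ ?_ ?_
      · rintro k p ⟨hp1, hp2⟩
        exact ⟨hp1, sol_eq_of_le (sol_pr p) (sol_pr q) (Nat.le_succ k) hp2⟩
      · intro k
        obtain ⟨p, hp, hpk⟩ := h k (pr q k)
        exact ⟨p, hp, hpk⟩
      · exact (hC.inter (isClosed_eq ((continuous_apply 0).comp continuous_pr)
          continuous_const)).isCompact
      · intro k
        exact hC.inter (isClosed_eq ((continuous_apply k).comp continuous_pr) continuous_const)
    obtain ⟨p, hp⟩ := hne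
    rw [mem_iInter] at hp
    have : q = p := X_uniq (funext fun k => (hp k).2.symm) hq
    rw [this]
    exact (hp 0).1
  exact univ_subset_iff.1 (dense_Reg.closure_eq ▸ hC.closure_subset_iff.2 hsub)

/-! ### The minimal homeomorphism -/

/-- The shift by `k`. -/
noncomputable def shf (k : ℤ) (p : X) : X :=
  ⟨(phi k * pr p, fun n => co p (n - k)), (sol_phi k).mul (sol_pr p), fun n =>
    ⟨co_mem p _, by
      by_cases h : pr p = phi ((n - k : ℤ) : ℝ)
      · left
        change phi k * pr p = phi n
        rw [h, ← phi_add]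
        congr 1
        push_cast
        ring
      · right
        change co p (n - k) = f (phi (-n) * (phi k * pr p))
        rw [co_eq p h, ← mul_assoc, ← phi_add]
        congr 3
        push_cast
        ring⟩⟩

lemma pr_shf (k : ℤ) (p : X) : pr (shf k p) = phi k * pr p := rfl

lemma co_shf (k : ℤ) (p : X) (n : ℤ) : co (shf k p) n = co p (n - k) := rfl

lemma continuous_shf (k : ℤ) : Continuous (shf k) := by
  refine continuous_iff_continuousAt.2 fun p => tendsto_X ?_ fun n => ?_
  · exact (continuous_const.mul continuous_pr).continuousAt
  · exact (continuous_co (n - k)).continuousAt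

lemma shf_shf (j k : ℤ) (p : X) : shf j (shf k p) = shf (j + k) p := by
  refine X_ext ?_ fun n => ?_
  · rw [pr_shf, pr_shf, pr_shf, ← mul_assoc, ← phi_add]
    push_cast
    rfl
  · rw [co_shf, co_shf, co_shf]
    congr 1
    ring

lemma shf_zero (p : X) : shf 0 p = p := by
  refine X_ext ?_ fun n => ?_
  · rw [pr_shf]
    simp [phi_zero]
  · rw [co_shf, sub_zero]

/-- The shift by `k` as a homeomorphism. -/
noncomputable def T (k : ℤ) : X ≃ₜ X where
  toFun := shf k
  invFun := shf (-k)
  left_inv p := by rw [shf_shf, neg_add_cancel, shf_zero]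
  right_inv p := by rw [shf_shf, add_neg_cancel, shf_zero]
  continuous_toFun := continuous_shf k
  continuous_invFun := continuous_shf (-k)

lemma T_apply (k : ℤ) (p : X) : T k p = shf k p := rfl

lemma T_iter (n : ℕ) : (fun S : X ≃ₜ X => S.trans (T 1))^[n] (Homeomorph.refl X) = T n := by
  induction n with
  | zero =>
    ext1 p
    exact (shf_zero p).symm
  | succ n ih =>
    rw [Function.iterate_succ_apply', ih]
    ext1 p
    change shf 1 (shf n p) = shf _ p
    rw [shf_shf]
    congr 1
    push_cast
    ring

lemma hzpow_T (k : ℤ) : hzpow (T 1) k = T k := by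
  cases k with
  | ofNat n => exact T_iter n
  | negSucc n =>
    change ((fun S : X ≃ₜ X => S.trans (T 1))^[n + 1] (Homeomorph.refl X)).symm = _
    rw [T_iter]
    ext1 p
    rfl

lemma T_iterate (n : ℕ) (p : X) : (T 1)^[n] p = shf n p := by
  induction n with
  | zero => exact (shf_zero p).symm
  | succ n ih =>
    rw [Function.iterate_succ_apply', ih]
    change shf 1 (shf n p) = shf _ p
    rw [shf_shf]
    congr 1
    push_cast
    ring

lemma dense_rot (k : ℕ) : DenseRange fun n : ℕ => Circle.exp (1 / 2 ^ k) ^ n := by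
  rw [← denseRange_zpow_iff_pow]
  have hirr : Irrational ((1 / 2 ^ k : ℝ) / (2 * Real.pi)) := by
    have h1 : (1 / 2 ^ k : ℝ) / (2 * Real.pi) = (((2 ^ (k + 1) : ℕ) : ℝ) * Real.pi)⁻¹ := by
      push_cast
      rw [pow_succ]
      field_simp
    rw [h1]
    exact (irrational_pi.natCast_mul (by positivity)).inv
  have hd := dense_addSubgroupClosure_pair_iff.2 hirr
  have hd2 := Circle.exp_surjective.denseRange.dense_image Circle.exp.continuous hd
  refine hd2.mono ?_
  rintro _ ⟨x, hx, rfl⟩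
  obtain ⟨m, n, rfl⟩ := AddSubgroup.mem_closure_pair.1 hx
  refine ⟨m, ?_⟩
  rw [Circle.exp_add, Circle.exp_zsmul, Circle.exp_zsmul, Circle.exp_two_pi, one_zpow, mul_one]

lemma minimal_T : IsMinimal (T 1) := by
  intro p
  rw [dense_iff_closure_eq]
  refine eq_univ_of_proj isClosed_closure fun k c => ?_
  have hcomp : IsCompact ((fun q : X => pr q k) '' closure (range fun n : ℕ => (T 1)^[n] p)) :=
    isClosed_closure.isCompact.image ((continuous_apply k).comp continuous_pr)
  have hd : DenseRange fun n : ℕ => Circle.exp (1 / 2 ^ k) ^ n * pr p k :=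
    (Homeomorph.mulRight (pr p k)).surjective.denseRange.comp (dense_rot k)
      (Homeomorph.mulRight (pr p k)).continuous
  have hsub : (range fun n : ℕ => Circle.exp (1 / 2 ^ k) ^ n * pr p k) ⊆
      (fun q : X => pr q k) '' closure (range fun n : ℕ => (T 1)^[n] p) := by
    rintro _ ⟨n, rfl⟩
    refine ⟨_, subset_closure ⟨n, rfl⟩, ?_⟩
    simp only [T_iterate, pr_shf, Pi.mul_apply]
    congr 1
    simp only [phi]
    rw [← Circle.exp_nsmul]
    congr 1
    rw [nsmul_eq_mul]
    push_cast
    ring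
  have := hcomp.isClosed.closure_subset_iff.2 hsub
  rw [hd.closure_eq] at this
  obtain ⟨q, hq, hqc⟩ := this (mem_univ c)
  exact ⟨q, hq, hqc⟩

/-! ### Indecomposability -/

lemma circle_lemma {A B : Set Circle} (hB : IsPreconnected B) (hU : A ∪ B = univ)
    {a b : Circle} (ha : ∀ x ∈ A, x ^ 2 ≠ a) (hb : ∀ x ∈ B, x ^ 2 ≠ b) : False := by
  obtain ⟨s, rfl⟩ := Circle.exp_surjective a
  obtain ⟨t, rfl⟩ := Circle.exp_surjective b
  have hsq : ∀ r : ℝ, Circle.exp (r / 2) ^ 2 = Circle.exp r := by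
    intro r
    rw [sq, ← Circle.exp_add, add_halves]
  set p := Circle.exp (s / 2) with hp
  set q := Circle.exp (t / 2) with hq
  have hnsq : ∀ x : Circle, (-x) ^ 2 = x ^ 2 := by
    intro x
    ext
    simp
  have hmem : ∀ x : Circle, x ^ 2 = Circle.exp s → x ∈ B := by
    intro x hx
    rcases (hU ▸ mem_univ x : x ∈ A ∪ B) with h | h
    · exact absurd hx (ha x h)
    · exact h
  have hpB : p ∈ B := hmem p (hsq s)
  have hpB' : -p ∈ B := hmem (-p) (by rw [hnsq]; exact hsq s)
  let g : Circle → ℝ := fun x => ((x / q : Circle) : ℂ).im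
  have hg : Continuous g := by
    have : Continuous (fun x : Circle => ((x / q : Circle) : ℂ)) := by fun_prop
    exact Complex.continuous_im.comp this
  have hgneg : g (-p) = - g p := by
    simp [g, neg_div]
  have hzero : ∃ x ∈ B, g x = 0 := by
    rcases le_total (g p) 0 with h | h
    · exact hB.intermediate_value hpB hpB' hg.continuousOn ⟨h, by rw [hgneg]; linarith⟩
    · exact hB.intermediate_value hpB' hpB hg.continuousOn ⟨by rw [hgneg]; linarith, h⟩
  obtain ⟨x, hx, hgx⟩ := hzero
  apply hb x hx
  have h1 : (x / q) ^ 2 = 1 := by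
    ext
    have hn := Circle.normSq_coe (x / q)
    rw [Complex.normSq_apply] at hn
    have hgx' : ((x / q : Circle) : ℂ).im = 0 := hgx
    rw [hgx'] at hn
    rw [Circle.coe_pow, Circle.coe_one, sq]
    apply Complex.ext
    · rw [Complex.mul_re, hgx', Complex.one_re]
      linarith
    · rw [Complex.mul_im, hgx', Complex.one_im]
      ring
  rw [div_pow, div_eq_one] at h1
  rw [h1]
  exact hsq t

lemma proj_surj (k : ℕ) (c : Circle) : ∃ t, phi t k = c := by
  obtain ⟨s, rfl⟩ := Circle.exp_surjective c
  refine ⟨s * 2 ^ k, ?_⟩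
  simp [phi]

lemma missing {A : Set X} (hA : IsCompact A) (hne : A ≠ univ) :
    ∃ k, ∀ j, k ≤ j → ∃ c : Circle, ∀ p ∈ A, pr p j ≠ c := by
  by_contra! hcon
  apply hne
  refine eq_univ_of_proj hA.isClosed fun k c => ?_
  obtain ⟨j, hj, h⟩ := hcon k
  obtain ⟨t, rfl⟩ := proj_surj k c
  obtain ⟨p, hp, hpj⟩ := h (phi t j)
  exact ⟨p, hp, sol_eq_of_le (sol_pr p) (sol_phi t) hj hpj⟩

lemma indecomposable : ¬ ∃ A B : Set X, IsCompact A ∧ IsConnected A ∧ A ≠ Set.univ ∧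
    IsCompact B ∧ IsConnected B ∧ B ≠ Set.univ ∧ A ∪ B = Set.univ := by
  rintro ⟨A, B, hA, -, hA', hB, hBc, hB', hU⟩
  obtain ⟨k, hk⟩ := missing hA hA'
  obtain ⟨l, hl⟩ := missing hB hB'
  obtain ⟨a, ha⟩ := hk (max k l) (le_max_left _ _)
  obtain ⟨b, hb⟩ := hl (max k l) (le_max_right _ _)
  set j := max k l
  have hc : Continuous fun p : X => pr p (j + 1) := (continuous_apply (j + 1)).comp continuous_pr
  refine circle_lemma (A := (fun p : X => pr p (j + 1)) '' A)
    (B := (fun p : X => pr p (j + 1)) '' B) (a := a) (b := b)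
    (hBc.isPreconnected.image _ hc.continuousOn) ?_ ?_ ?_
  · rw [← image_union, hU, image_univ, range_eq_univ]
    intro c
    obtain ⟨t, ht⟩ := proj_surj (j + 1) c
    exact ⟨lam1 t, by simpa [pr_lam1] using ht⟩
  · rintro _ ⟨p, hp, rfl⟩
    simp only [sol_pr p j]
    exact ha p hp
  · rintro _ ⟨p, hp, rfl⟩
    simp only [sol_pr p j]
    exact hb p hp

/-! ### Path components -/

/-- The non-dense path components. -/
def K (n : ℤ) : Set X := {p | ∃ t ∈ Ioc (n : ℝ) (n + 1), pr p = phi t}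

/-- Their closures. -/
def Kb (n : ℤ) : Set X := {p | ∃ t ∈ Icc (n : ℝ) (n + 1), pr p = phi t}

lemma isClosed_Kb (n : ℤ) : IsClosed (Kb n) := by
  have h : Kb n = pr ⁻¹' (phi '' Icc (n : ℝ) (n + 1)) := by
    ext p
    constructor
    · rintro ⟨t, ht, h⟩
      exact ⟨t, ht, h.symm⟩
    · rintro ⟨t, ht, h⟩
      exact ⟨t, ht, h.symm⟩
  rw [h]
  exact (isCompact_Icc.image continuous_phi).isClosed.preimage continuous_pr

lemma K_subset_Kb (n : ℤ) : K n ⊆ Kb n := fun _ ⟨t, ht, h⟩ => ⟨t, ⟨ht.1.le, ht.2⟩, h⟩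

lemma closure_K (n : ℤ) : closure (K n) = Kb n := by
  refine ((isClosed_Kb n).closure_subset_iff.2 (K_subset_Kb n)).antisymm ?_
  rintro p ⟨t, ht, h⟩
  rcases ht.1.eq_or_lt with h' | h'
  · rw [← h'] at h
    refine closure_mono ?_ (fibre_mem_closure h)
    rintro _ ⟨s, hs, rfl⟩
    exact ⟨s, ⟨hs.1, hs.2.le⟩, pr_lam1 s⟩
  · exact subset_closure ⟨t, ⟨h', ht.2⟩, h⟩

lemma lam1_continuousOn (n : ℤ) : ContinuousOn lam1 (Ioc (n : ℝ) (n + 1)) := by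
  intro t ht
  refine tendsto_X ?_ fun m => ?_
  · simp only [pr_lam1]
    exact continuous_phi.continuousWithinAt
  · simp only [co_lam1]
    by_cases hm : t - m = 0
    · have htm : t = m := sub_eq_zero.1 hm
      have hmn : m = n + 1 := by
        rw [htm] at ht
        obtain ⟨h1, h2⟩ := ht
        have h1' : n < m := by exact_mod_cast h1
        have h2' : m ≤ n + 1 := by exact_mod_cast h2
        omega
      rw [hm, phi_zero, f_one]
      refine tendsto_const_nhds.congr' ?_
      filter_upwards [self_mem_nhdsWithin] with s hs
      rw [f_phi_neg]
      · rw [hmn]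
        push_cast
        linarith [hs.1]
      · rw [hmn]
        push_cast
        linarith [hs.2]
    · refine ContinuousAt.continuousWithinAt ?_
      exact ContinuousAt.comp (g := fun t => f (phi t)) (f := fun t : ℝ => t - m)
        (tendsto_f_phi hm) (by fun_prop)

lemma not_int_of_Ioo {n : ℤ} {t : ℝ} (h1 : (n : ℝ) < t) (h2 : t < n + 1) (m : ℤ) :
    t ≠ m := by
  rintro rfl
  have h1' : n < m := by exact_mod_cast h1
  have h2' : m < n + 1 := by exact_mod_cast h2
  omega

lemma joined_end {n : ℤ} {p : X} (hp : p ∈ K n) : Joined p (lam1 ((n : ℝ) + 1)) := by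
  obtain ⟨t, ht, hpt⟩ := hp
  rcases ht.2.eq_or_lt with h | h
  · skip
    have hpn : pr p = phi ((n + 1 : ℤ) : ℝ) := by
      rw [hpt, h]
      push_cast
      rfl
    have hq : pr (lam1 ((n : ℝ) + 1)) = pr p := by
      rw [pr_lam1, hpt, h]
    let c : Icc (-1 : ℝ) 1 → X := fun s =>
      ⟨(pr p, Function.update (co p) (n + 1) s), sol_pr p, fun m => by
        by_cases hm : m = n + 1
        · subst hm
          exact ⟨by simp, Or.inl hpn⟩
        · have := p.2.2 m
          simpa [Function.update_of_ne hm, pr, co] using this⟩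
    have hc : Continuous c := by
      refine Continuous.subtype_mk ?_ _
      refine continuous_const.prodMk ?_
      exact continuous_const.update (n + 1) continuous_subtype_val
    have hpc : p = c ⟨co p (n + 1), co_mem p _⟩ := by
      refine X_ext rfl fun m => ?_
      change co p m = Function.update (co p) (n + 1) (co p (n + 1)) m
      rw [Function.update_eq_self]
    have hqc : lam1 ((n : ℝ) + 1) = c ⟨co (lam1 ((n : ℝ) + 1)) (n + 1), co_mem _ _⟩ := by
      refine X_ext hq fun m => ?_
      change _ = Function.update (co p) (n + 1) (co (lam1 ((n : ℝ) + 1)) (n + 1)) m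
      by_cases hm : m = n + 1
      · subst hm
        simp
      · rw [Function.update_of_ne hm]
        have hne : pr p ≠ phi m := by
          rw [hpn]
          intro h'
          have := phi_inj h'
          exact hm (by exact_mod_cast this.symm)
        rw [co_eq _ hne, co_eq _ (hq ▸ hne), hq]
    have hpc' : PathConnectedSpace (Icc (-1 : ℝ) 1) :=
      isPathConnected_iff_pathConnectedSpace.1
        ((convex_Icc (-1 : ℝ) 1).isPathConnected ⟨0, by norm_num⟩)
    have := (PathConnectedSpace.joined (⟨co p (n + 1), co_mem p _⟩ : Icc (-1 : ℝ) 1)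
      ⟨co (lam1 ((n : ℝ) + 1)) (n + 1), co_mem _ _⟩).map hc
    rw [← hpc, ← hqc] at this
    exact this
  · have hp1 : p = lam1 t := by
      refine X_uniq (by rw [pr_lam1, hpt]) fun m hm => ?_
      rw [hpt] at hm
      exact not_int_of_Ioo ht.1 h m (phi_inj hm)
    have hpath : IsPathConnected (lam1 '' Ioc (n : ℝ) (n + 1)) :=
      IsPathConnected.image' ((convex_Ioc _ _).isPathConnected ⟨t, ht⟩) (lam1_continuousOn n)
    rw [hp1]
    exact (hpath.joinedIn _ ⟨t, ht, rfl⟩ _ ⟨(n : ℝ) + 1, ⟨by linarith, le_rfl⟩, rfl⟩).joined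

lemma K_joined {n : ℤ} {p q : X} (hp : p ∈ K n) (hq : q ∈ K n) : Joined p q :=
  (joined_end hp).trans (joined_end hq).symm

lemma lam_continuous {x : ℕ → Circle} (hx : Sol x) (hx' : ∀ t, x ≠ phi t) :
    Continuous (lam x hx) := by
  refine continuous_iff_continuousAt.2 fun t => tendsto_X ?_ fun m => ?_
  · simp only [pr_lam]
    exact (continuous_phi.mul continuous_const).continuousAt
  · simp only [co_lam]
    have hne : phi (t - m) * x ≠ 1 := by
      intro h
      apply hx' (-(t - m))
      rw [phi_neg]
      exact (inv_eq_of_mul_eq_one_right h).symm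
    exact ContinuousAt.comp (f := fun t : ℝ => phi (t - m) * x) (continuousAt_f hne)
      ((continuous_phi.comp (continuous_id.sub continuous_const)).mul
        continuous_const).continuousAt

/-- Path components off the distinguished leaf are dense. -/
lemma dense_joined {p : X} (hp : ∀ t, pr p ≠ phi t) : Dense {q | Joined p q} := by
  rw [dense_iff_closure_eq]
  refine eq_univ_of_proj isClosed_closure fun k c => ?_
  have hp0 : p = lam (pr p) (sol_pr p) 0 := by
    refine X_uniq ?_ fun n => hp n
    rw [pr_lam, phi_zero, one_mul]
  obtain ⟨t, ht⟩ := proj_surj k (c / pr p k)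
  refine ⟨lam (pr p) (sol_pr p) t, subset_closure ?_, ?_⟩
  · have := (PathConnectedSpace.joined (0 : ℝ) t).map (lam_continuous (sol_pr p) hp)
    rw [← hp0] at this
    exact this
  · rw [pr_lam, Pi.mul_apply, ht, div_mul_cancel]

/-- Lifting paths to the leaf. -/
lemma path_lift {p q : X} (γ : Path p q) {t : ℝ} (ht : pr p = phi t) :
    ∃ s : ℝ → ℝ, ∃ g : ℝ → X, Continuous s ∧ Continuous g ∧ s 0 = t ∧ g 0 = p ∧ g 1 = q ∧
      ∀ u, pr (g u) = phi (s u) := by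
  let γ0 : C(unitInterval, Circle) :=
    ⟨fun u => pr (γ u) 0, (continuous_apply 0).comp (continuous_pr.comp γ.continuous)⟩
  have h0 : γ0 0 = Circle.exp t := by
    change pr (γ 0) 0 = _
    rw [γ.source, ht]
    simp [phi]
  obtain ⟨S, hS1, hS2⟩ := Circle.isCoveringMap_exp.exists_path_lifts γ0 t h0
  have hS : ∀ k u, pr (γ u) k = phi (S u) k := by
    intro k
    induction k with
    | zero =>
      intro u
      have := congrFun hS1 u
      simp only [Function.comp_apply] at this
      change Circle.exp (S u) = pr (γ u) 0 at this
      rw [← this]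
      simp [phi]
    | succ k ih =>
      have hc1 : Continuous fun u => ((pr (γ u) (k + 1) : Circle) : ℂ) := by
        have : Continuous fun u => pr (γ u) (k + 1) :=
          (continuous_apply (k + 1)).comp (continuous_pr.comp γ.continuous)
        fun_prop
      have hc2 : Continuous fun u => ((phi (S u) (k + 1) : Circle) : ℂ) := by
        have : Continuous fun u => phi (S u) (k + 1) :=
          (continuous_apply (k + 1)).comp (continuous_phi.comp S.continuous)
        fun_prop
      have := isPreconnected_univ.eq_of_sq_eq (S := (univ : Set unitInterval))
        hc1.continuousOn hc2.continuousOn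
        (by
          intro u _
          simp only [Pi.pow_apply]
          rw [← Circle.coe_pow, ← Circle.coe_pow, sol_pr (γ u) k, phi_sq, ih u])
        (by
          intro u _
          exact Circle.coe_ne_zero _)
        (mem_univ 0) (by rw [γ.source, hS2, ht])
      intro u
      exact Circle.coe_injective (this (mem_univ u))
  refine ⟨fun u => S (projIcc 0 1 zero_le_one u), γ.extend, ?_, γ.continuous_extend, ?_, ?_, ?_, ?_⟩
  · exact S.continuous.comp continuous_projIcc
  · simp only [projIcc_left]
    exact hS2
  · simp
  · simp
  · intro u
    exact funext fun k => hS k _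

/-- A path cannot cross an arc. -/
lemma no_cross {s : ℝ → ℝ} {g : ℝ → X} (hs : Continuous s) (hg : Continuous g)
    (h : ∀ u, pr (g u) = phi (s u)) {m : ℤ} (h0 : s 0 ≤ m) (h1 : m < s 1) : False := by
  have hcomp : IsCompact {u | u ∈ Icc (0 : ℝ) 1 ∧ s u ≤ m} :=
    isCompact_Icc.inter_right (isClosed_le hs continuous_const)
  obtain ⟨a, ⟨haI, ham⟩, hmax⟩ := hcomp.exists_isGreatest ⟨0, ⟨le_rfl, zero_le_one⟩, h0⟩
  have ha1 : a < 1 := by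
    refine lt_of_le_of_ne haI.2 ?_
    rintro rfl
    linarith
  have hgt : ∀ u, a < u → u ≤ 1 → m < s u := by
    intro u hu hu1
    by_contra! hle
    have := hmax ⟨⟨haI.1.trans hu.le, hu1⟩, hle⟩
    linarith
  have hc : Continuous fun u => co (g u) m := (continuous_co m).comp hg
  obtain ⟨d, hd, hdist⟩ := Metric.continuousAt_iff.1 (hc.continuousAt (x := a)) 1 one_pos
  set b := min (a + d / 2) 1 with hb
  have hab : a < b := lt_min (by linarith) ha1
  have hbd : b < a + d := lt_of_le_of_lt (min_le_left _ _) (by linarith)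
  have hmb : m < s b := hgt b hab (min_le_right _ _)
  have key : ∀ y ∈ Icc (-1 : ℝ) 1, |y - co (g a) m| < 1 := by
    intro y hy
    obtain ⟨e, he0, he1, hey⟩ := f_osc hy (sub_pos.2 hmb)
    have hiv := intermediate_value_Icc hab.le hs.continuousOn
    obtain ⟨u, hu, hue⟩ := hiv (⟨by linarith, by linarith⟩ : (m : ℝ) + e ∈ Icc (s a) (s b))
    have hne : pr (g u) ≠ phi m := by
      rw [h, hue]
      intro h'
      have := phi_inj h'
      linarith
    have hco : co (g u) m = y := by
      rw [co_eq _ hne, h, hue, ← phi_add, ← hey]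
      congr 2
      ring
    have := hdist (x := u) (by
      rw [Real.dist_eq, abs_of_nonneg (by linarith [hu.1])]
      linarith [hu.2])
    rw [hco, Real.dist_eq] at this
    exact this
  have k1 := abs_lt.1 (key 1 (by norm_num))
  have k2 := abs_lt.1 (key (-1) (by norm_num))
  linarith [k1.2, k2.1]

lemma joined_K {n : ℤ} {p q : X} (hp : p ∈ K n) (hpq : Joined p q) : q ∈ K n := by
  obtain ⟨t, ht, hpt⟩ := hp
  obtain ⟨γ⟩ := hpq
  obtain ⟨s, g, hs, hg, hs0, hg0, hg1, hsg⟩ := path_lift γ hpt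
  refine ⟨s 1, ⟨?_, ?_⟩, by rw [← hg1, hsg]⟩
  · by_contra! hle
    refine no_cross (s := fun u => s (1 - u)) (g := fun u => g (1 - u)) (m := n)
      (by fun_prop) (by fun_prop) (fun u => hsg _) ?_ ?_
    · simpa using hle
    · simp only [sub_self, hs0]
      exact ht.1
  · by_contra! hlt
    refine no_cross hs hg hsg (m := n + 1) ?_ ?_
    · rw [hs0]
      push_cast
      exact ht.2
    · push_cast
      exact hlt

lemma joined_eq_K {n : ℤ} {p : X} (hp : p ∈ K n) : {q | Joined p q} = K n :=
  Subset.antisymm (fun _ hq => joined_K hp hq) fun _ hq => K_joined hp hq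

lemma not_dense_K (n : ℤ) : ¬ Dense (K n) := by
  intro h
  rw [dense_iff_closure_eq, closure_K] at h
  obtain ⟨t, ht, h'⟩ := (h ▸ mem_univ (lam1 ((n : ℝ) + 2)) : lam1 ((n : ℝ) + 2) ∈ Kb n)
  rw [pr_lam1] at h'
  have := phi_inj h'
  linarith [ht.2]

lemma exists_K {p : X} {t : ℝ} (h : pr p = phi t) : ∃ n : ℤ, p ∈ K n := by
  refine ⟨⌈t⌉ - 1, t, ⟨?_, ?_⟩, h⟩
  · push_cast
    linarith [Int.ceil_lt_add_one t]
  · push_cast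
    linarith [Int.le_ceil t]

/-! ### Connectedness -/

lemma lam1_int (n : ℤ) : lam1 ((n : ℝ) + 1) ∈ K n :=
  ⟨(n : ℝ) + 1, ⟨by linarith, le_rfl⟩, pr_lam1 _⟩

lemma connected_Kb (n : ℤ) : IsConnected (Kb n) := by
  rw [← closure_K]
  have : IsPathConnected (K n) := by
    rw [← joined_eq_K (lam1_int n)]
    exact isPathConnected_pathComponent
  exact this.isConnected.closure

lemma connected_X : ConnectedSpace X := by
  have hpre : IsPreconnected (⋃ n : ℤ, Kb n) := by
    refine IsPreconnected.iUnion_of_chain (fun n => (connected_Kb n).isPreconnected) fun n => ?_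
    refine ⟨lam1 ((n : ℝ) + 1), K_subset_Kb _ (lam1_int n), (n : ℝ) + 1, ⟨?_, ?_⟩, pr_lam1 _⟩
    · simp
    · simp
  have huniv : closure (⋃ n : ℤ, Kb n) = univ := by
    refine eq_univ_of_proj isClosed_closure fun k c => ?_
    obtain ⟨t, ht⟩ := proj_surj k c
    obtain ⟨n, hn⟩ := exists_K (pr_lam1 t)
    refine ⟨lam1 t, subset_closure (mem_iUnion.2 ⟨n, K_subset_Kb n hn⟩), ?_⟩
    rw [pr_lam1, ht]
  have h2 := hpre.closure
  rw [huniv] at h2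
  exact { isPreconnected_univ := h2, toNonempty := ⟨lam1 0⟩ }

/-! ### Rigidity -/

lemma K_disjoint {m n : ℤ} {p : X} (h1 : p ∈ K m) (h2 : p ∈ K n) : m = n := by
  obtain ⟨s, hs, hs'⟩ := h1
  obtain ⟨t, ht, ht'⟩ := h2
  have hst : s = t := phi_inj (hs'.symm.trans ht')
  subst hst
  have a1 : (m : ℝ) < n + 1 := lt_of_lt_of_le hs.1 ht.2
  have a2 : (n : ℝ) < m + 1 := lt_of_lt_of_le ht.1 hs.2
  have a1' : m < n + 1 := by exact_mod_cast a1
  have a2' : n < m + 1 := by exact_mod_cast a2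
  omega

lemma Kb_inter_K {m n : ℤ} {p : X} (h1 : p ∈ Kb m) (h2 : p ∈ K n) (hne : n ≠ m) :
    n = m - 1 ∧ pr p = phi m := by
  obtain ⟨s, hs, hs'⟩ := h1
  rcases hs.1.eq_or_lt with h | h
  · rw [← h] at hs'
    refine ⟨K_disjoint h2 ⟨m, ⟨?_, ?_⟩, hs'⟩, hs'⟩
    · push_cast
      linarith
    · push_cast
      linarith
  · exact absurd (K_disjoint h2 ⟨s, ⟨h, hs.2⟩, hs'⟩) hne

lemma homeo_joined (S : X ≃ₜ X) (p : X) : S '' {q | Joined p q} = {q | Joined (S p) q} := by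
  ext q
  constructor
  · rintro ⟨r, hr, rfl⟩
    exact Joined.map hr S.continuous
  · intro hq
    refine ⟨S.symm q, ?_, S.apply_symm_apply q⟩
    have := Joined.map hq S.symm.continuous
    rwa [S.symm_apply_apply] at this

lemma homeo_K (S : X ≃ₜ X) (n : ℤ) : ∃ m : ℤ, S '' K n = K m := by
  have hp := lam1_int n
  set p := lam1 ((n : ℝ) + 1)
  have hnd : ¬ Dense {q | Joined (S p) q} := by
    intro hd
    rw [← homeo_joined, joined_eq_K hp] at hd
    have h2 := S.symm.surjective.denseRange.dense_image S.symm.continuous hd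
    rw [← image_comp] at h2
    simp only [Homeomorph.symm_comp_self, image_id] at h2
    exact not_dense_K n h2
  have hex : ∃ t, pr (S p) = phi t := by
    by_contra! hcon
    exact hnd (dense_joined hcon)
  obtain ⟨t, ht⟩ := hex
  obtain ⟨m, hm⟩ := exists_K ht
  refine ⟨m, ?_⟩
  rw [← joined_eq_K hp, homeo_joined, joined_eq_K hm]

lemma rigid (S : X ≃ₜ X) : ∃ k : ℤ, S = T k := by
  choose σ hσ using homeo_K S
  have hσb : ∀ n, S '' Kb n = Kb (σ n) := by
    intro n
    rw [← closure_K, S.image_closure, hσ, closure_K]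
  have hstep : ∀ n : ℤ, ∀ p : X, pr p = phi n → σ (n - 1) = σ n - 1 ∧ pr (S p) = phi (σ n) := by
    intro n p hp
    have h1 : p ∈ Kb n := ⟨n, ⟨le_rfl, by linarith⟩, hp⟩
    have h2 : p ∈ K (n - 1) := ⟨n, ⟨by push_cast; linarith, by push_cast; linarith⟩, hp⟩
    have h1' : S p ∈ Kb (σ n) := hσb n ▸ mem_image_of_mem S h1
    have h2' : S p ∈ K (σ (n - 1)) := hσ (n - 1) ▸ mem_image_of_mem S h2
    refine Kb_inter_K h1' h2' fun heq => ?_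
    have h3 : S '' K (n - 1) = S '' K n := by rw [hσ, hσ, heq]
    have h4 : K (n - 1) = K n := S.injective.image_injective h3
    have := K_disjoint h2 (h4 ▸ h2)
    omega
  have hstep1 : ∀ n : ℤ, σ (n - 1) = σ n - 1 := fun n => (hstep n (lam1 n) (pr_lam1 _)).1
  have hσn : ∀ n : ℤ, σ n = σ 0 + n := by
    intro n
    induction n with
    | zero => simp
    | succ i ih =>
      have := hstep1 (i + 1)
      rw [add_sub_cancel_right] at this
      omega
    | pred i ih =>
      rw [hstep1, ih]
      ring
  refine ⟨σ 0, ?_⟩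
  have hpr : ∀ p, pr (S p) = pr (T (σ 0) p) := by
    have hd : Dense {p : X | ∃ n : ℤ, pr p = phi n} := by
      refine (minimal_T (lam1 0)).mono ?_
      rintro _ ⟨n, rfl⟩
      refine ⟨n, ?_⟩
      simp only [T_iterate, pr_shf, pr_lam1, phi_zero, mul_one]
    have := Continuous.ext_on hd (continuous_pr.comp S.continuous)
      (continuous_pr.comp (T (σ 0)).continuous) (by
        rintro p ⟨n, hn⟩
        simp only [Function.comp_apply]
        rw [(hstep n p hn).2, T_apply, pr_shf, hn, ← phi_add, hσn n]
        push_cast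
        rfl)
    exact fun p => congrFun this p
  have hS : (S : X → X) = T (σ 0) := by
    refine Continuous.ext_on dense_Reg S.continuous (T (σ 0)).continuous ?_
    intro p hp
    refine X_uniq (hpr p) fun n hn => ?_
    rw [hpr, T_apply, pr_shf] at hn
    apply hp (n - σ 0)
    push_cast
    rw [sub_eq_add_neg, phi_add, phi_neg, ← hn, mul_comm, inv_mul_cancel_left]
  exact Homeomorph.ext fun p => congrFun hS p

lemma three_points : ∃ a b c : X, a ≠ b ∧ a ≠ c ∧ b ≠ c := by
  have h : ∀ s t : ℝ, s ≠ t → lam1 s ≠ lam1 t := by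
    intro s t hst heq
    apply hst
    apply phi_inj
    rw [← pr_lam1, ← pr_lam1, heq]
  exact ⟨lam1 0, lam1 1, lam1 2, h _ _ (by norm_num), h _ _ (by norm_num), h _ _ (by norm_num)⟩

end SlovakInd

/-- There exists a Slovak space which is an indecomposable continuum: a compact connected
metric space, not the union of two proper subcontinua, with at least three points, carrying a
minimal homeomorphism `T` such that every self-homeomorphism equals `Tⁿ` for some `n : ℤ`. -/
theorem exists_indecomposable_slovak_space :
    ∃ (X : Type) (_ : MetricSpace X), CompactSpace X ∧ ConnectedSpace X ∧ Nonempty X ∧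
      (¬ ∃ A B : Set X, IsCompact A ∧ IsConnected A ∧ A ≠ Set.univ ∧
          IsCompact B ∧ IsConnected B ∧ B ≠ Set.univ ∧ A ∪ B = Set.univ) ∧
      (∃ a b c : X, a ≠ b ∧ a ≠ c ∧ b ≠ c) ∧
      ∃ T : X ≃ₜ X, IsMinimal ⇑T ∧ ∀ S : X ≃ₜ X, ∃ n : ℤ, S = hzpow T n := by
  refine ⟨SlovakInd.X, TopologicalSpace.metrizableSpaceMetric SlovakInd.X, ?_⟩
  refine ⟨inferInstance, SlovakInd.connected_X, ⟨SlovakInd.lam1 0⟩, SlovakInd.indecomposable,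
    SlovakInd.three_points, SlovakInd.T 1, SlovakInd.minimal_T, fun S => ?_⟩
  obtain ⟨k, hk⟩ := SlovakInd.rigid S
  exact ⟨k, by rw [SlovakInd.hzpow_T, hk]⟩
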